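/- Suppose E[S] = 1 and that for some integer n' ≥ 1 and constants C_2 > 0 and r_2 > 2, for all t ∈ [0,1], E[|∑_{i=1}^{n'} N_i(t) − n' t|^{r_2}] ≤ C_2 max(n' t, (n' t)^{r_2/2}). Then for all t_0 ∈ [0,1] and all λ ≥ 2, P(sup_{t ∈ [0, t_0]}(n' t − ∑_{i=1}^{n'} N_i(t)) ≥ λ) ≤ (24(r_2+1)/(r_2−2))^{r_2+1} C_2 (n' t_0)^{r_2/2} λ^{−r_2}. -/

import Mathlib

open MeasureTheory ProbabilityTheory
open scoped NNReal ENNReal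

/-- The number of renewals in `[0, t]` of a renewal process whose successive renewal
intervals are `ξ 0, ξ 1, ξ 2, ...`. -/
noncomputable def renewalCount (ξ : ℕ → ℝ) (t : ℝ) : ℕ :=
  sSup {n : ℕ | ∑ i ∈ Finset.range n, ξ i ≤ t}
/-- Lebesgue measure on the nonnegative half line. -/
noncomputable abbrev leb0 : Measure ℝ := (volume : Measure ℝ).restrict (Set.Ici 0)

/-- convolution powers -/
noncomputable def convPow (F : Measure ℝ) : ℕ → Measure ℝ
  | 0 => Measure.dirac 0
  | (k+1) => F ∗ convPow F k

instance convPow_prob (F : Measure ℝ) [IsProbabilityMeasure F] (k : ℕ) :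
    IsProbabilityMeasure (convPow F k) := by
  induction k with
  | zero => unfold convPow; infer_instance
  | succ k ih => unfold convPow; infer_instance

lemma R_eq_density (R F : Measure ℝ) [IsProbabilityMeasure R] [IsProbabilityMeasure F]
    (hR0 : R (Set.Iio 0) = 0)
    (hR : ∀ y : ℝ, 0 ≤ y → R (Set.Ioi y) = ∫⁻ z in Set.Ioi y, F (Set.Ioi z))
    (h1 : ∫⁻ z in Set.Ioi (0:ℝ), F (Set.Ioi z) = 1) :
    R = leb0.withDensity (fun z => F (Set.Ioi z)) := by
  have hm : Measurable (fun z : ℝ => F (Set.Ioi z)) :=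
    Antitone.measurable (fun a b hab => measure_mono (Set.Ioi_subset_Ioi hab))
  have hP : IsProbabilityMeasure (leb0.withDensity (fun z => F (Set.Ioi z))) := by
    constructor
    rw [withDensity_apply _ MeasurableSet.univ, Measure.restrict_univ]
    rw [← h1]
    exact setLIntegral_congr Ioi_ae_eq_Ici.symm
  have key : ∀ a : ℝ, R (Set.Ioi a) = (leb0.withDensity (fun z => F (Set.Ioi z))) (Set.Ioi a) := by
    intro a
    rw [withDensity_apply _ measurableSet_Ioi, Measure.restrict_restrict measurableSet_Ioi]
    rcases le_or_gt 0 a with ha | ha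
    · rw [hR a ha]
      congr 2
      ext x; simp; intro h; linarith
    · have : Set.Ioi a ∩ Set.Ici (0:ℝ) = Set.Ici 0 := by
        ext x; simp; intro h; linarith
      rw [this, setLIntegral_congr Ioi_ae_eq_Ici.symm, h1]
      have h2 : R (Set.Iic a) = 0 := measure_mono_null (fun x hx => lt_of_le_of_lt hx ha) hR0
      have := prob_compl_eq_one_sub (μ := R) (measurableSet_Iic (a := a))
      rw [Set.compl_Iic] at this
      rw [this, h2]; simp
  apply Measure.ext_of_Iic
  intro a
  have e1 := prob_compl_eq_one_sub (μ := R) (measurableSet_Ioi (a := a))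
  have e2 := prob_compl_eq_one_sub (μ := leb0.withDensity (fun z => F (Set.Ioi z))) (measurableSet_Ioi (a := a))
  rw [Set.compl_Ioi] at e1 e2
  rw [e1, e2, key]

lemma leb_renewal (R F : Measure ℝ) [IsProbabilityMeasure R] [IsProbabilityMeasure F]
    (hF0 : F (Set.Iio 0) = 0)
    (hR : R = leb0.withDensity (fun z => F (Set.Ioi z))) :
    R + leb0 ∗ F = leb0 := by
  have hm : Measurable (fun z : ℝ => F (Set.Ioi z)) :=
    Antitone.measurable (fun a b hab => measure_mono (Set.Ioi_subset_Ioi hab))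
  have hm2 : Measurable (fun z : ℝ => F (Set.Iic z)) :=
    Monotone.measurable (fun a b hab => measure_mono (Set.Iic_subset_Iic.2 hab))
  ext B hB
  rw [Measure.add_apply, hR, withDensity_apply _ hB]
  have h1 : (leb0 ∗ F) B = ∫⁻ v in B, F (Set.Iic v) ∂leb0 := by
    rw [← lintegral_indicator_one hB, Measure.lintegral_conv (measurable_one.indicator hB)]
    rw [lintegral_lintegral_swap (by
      apply Measurable.aemeasurable
      exact (measurable_one.indicator hB).comp (by fun_prop))]
    have : ∀ y : ℝ, ∫⁻ x in Set.Ici 0, B.indicator (1 : ℝ → ℝ≥0∞) (x + y)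
        = ∫⁻ v in B, (Set.Iic v).indicator (1 : ℝ → ℝ≥0∞) y := by
      intro y
      rw [← lintegral_indicator measurableSet_Ici, ← lintegral_indicator hB]
      conv_rhs => rw [← lintegral_add_right_eq_self _ y]
      apply lintegral_congr
      intro x
      by_cases hx : x + y ∈ B <;> by_cases h0 : 0 ≤ x <;> simp [Set.indicator, hx, h0]
    simp_rw [this]
    rw [lintegral_lintegral_swap (by
      apply Measurable.aemeasurable
      have : Function.uncurry (fun (x y : ℝ) => (Set.Iic y).indicator (1 : ℝ → ℝ≥0∞) x)
          = {p : ℝ × ℝ | p.1 ≤ p.2}.indicator 1 := by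
        ext p; simp [Set.indicator, Function.uncurry]
      rw [this]
      exact measurable_one.indicator (measurableSet_le measurable_fst measurable_snd))]
    simp_rw [lintegral_indicator_one measurableSet_Iic]
    rw [Measure.restrict_restrict hB, ← lintegral_indicator hB, ← lintegral_indicator (hB.inter measurableSet_Ici)]
    apply lintegral_congr
    intro v
    by_cases hv : v ∈ B <;> by_cases h0 : 0 ≤ v <;> simp [Set.indicator, hv, h0]
    exact measure_mono_null (fun x hx => lt_of_le_of_lt hx (not_le.1 h0)) hF0
  rw [h1, ← lintegral_add_left hm]
  have : ∀ v : ℝ, F (Set.Ioi v) + F (Set.Iic v) = 1 := by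
    intro v
    rw [← Set.compl_Iic, add_comm]
    exact prob_add_prob_compl measurableSet_Iic
  simp [this]

section
variable {R F : Measure ℝ} [IsProbabilityMeasure R] [IsProbabilityMeasure F]

lemma leb_conv_step (h : R + leb0 ∗ F = leb0) (k : ℕ) :
    R ∗ convPow F k + leb0 ∗ convPow F (k+1) = leb0 ∗ convPow F k := by
  conv_rhs => rw [← h]
  rw [Measure.add_conv, Measure.conv_assoc]
  rfl

lemma leb_conv_sum (h : R + leb0 ∗ F = leb0) (n : ℕ) :
    (∑ k ∈ Finset.range n, R ∗ convPow F k) + leb0 ∗ convPow F n = leb0 := by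
  induction n with
  | zero => simp [convPow]
  | succ n ih => rw [Finset.sum_range_succ, add_assoc, leb_conv_step h, ih]

lemma leb_conv_lintegral (h : R + leb0 ∗ F = leb0) (n : ℕ) (f : ℝ → ℝ≥0∞) :
    (∑ k ∈ Finset.range n, ∫⁻ x, f x ∂(R ∗ convPow F k)) + ∫⁻ x, f x ∂(leb0 ∗ convPow F n)
      = ∫⁻ x, f x ∂leb0 := by
  conv_rhs => rw [← leb_conv_sum h n]
  rw [lintegral_add_measure, lintegral_finsetSum_measure]

lemma leb0_Iic (t : ℝ) : leb0 (Set.Iic t) = ENNReal.ofReal t := by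
  rw [Measure.restrict_apply measurableSet_Iic, Set.Iic_inter_Ici]
  simp

lemma U_sum_le (h : R + leb0 ∗ F = leb0) (t : ℝ) :
    ∑' k, (R ∗ convPow F k) (Set.Iic t) ≤ ENNReal.ofReal t := by
  rw [ENNReal.tsum_eq_iSup_nat]
  refine iSup_le fun n => ?_
  rw [← leb0_Iic]
  conv_rhs => rw [← leb_conv_sum h n]
  rw [Measure.add_apply, Measure.finsetSum_apply]
  exact le_self_add

lemma conv_ge (A B : Measure ℝ) [SFinite A] [SFinite B] (a b : ℝ) :
    A (Set.Iic a) * B (Set.Iic b) ≤ (A ∗ B) (Set.Iic (a+b)) := by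
  rw [Measure.conv, Measure.map_apply (by fun_prop) measurableSet_Iic, ← Measure.prod_prod]
  apply measure_mono
  rintro ⟨x, y⟩ ⟨hx, hy⟩
  simp at *
  linarith

lemma convPow_tendsto (h : R + leb0 ∗ F = leb0) (t : ℝ) :
    Filter.Tendsto (fun n => convPow F n (Set.Iic t)) Filter.atTop (nhds 0) := by
  obtain ⟨c, hc⟩ : ∃ c : ℕ, R (Set.Iic (c:ℝ)) ≠ 0 := by
    by_contra hcon
    push Not at hcon
    have : R Set.univ = 0 := by
      rw [show (Set.univ : Set ℝ) = ⋃ c : ℕ, Set.Iic (c:ℝ) by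
        ext x; simpa using exists_nat_ge x]
      exact measure_iUnion_null hcon
    simp at this
  have h1 : Filter.Tendsto (fun n => (R ∗ convPow F n) (Set.Iic (c+t))) Filter.atTop (nhds 0) := by
    apply ENNReal.tendsto_atTop_zero_of_tsum_ne_top
    exact ne_top_of_le_ne_top ENNReal.ofReal_ne_top (U_sum_le h _)
  have h2 : Filter.Tendsto (fun n => (R ∗ convPow F n) (Set.Iic (c+t)) / R (Set.Iic (c:ℝ))) Filter.atTop (nhds 0) := by
    have := ENNReal.Tendsto.div_const h1 (b := R (Set.Iic (c:ℝ))) (Or.inr hc)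
    simpa using this
  refine tendsto_of_tendsto_of_tendsto_of_le_of_le tendsto_const_nhds h2 (fun _ => zero_le) ?_
  intro n
  show convPow F n (Set.Iic t) ≤ (R ∗ convPow F n) (Set.Iic (c+t)) / R (Set.Iic (c:ℝ))
  rw [ENNReal.le_div_iff_mul_le (Or.inl hc) (Or.inl (measure_ne_top _ _)), mul_comm]
  exact conv_ge _ _ _ _

lemma conv_nonneg (A B : Measure ℝ) [SFinite A] [SFinite B] (hA : A (Set.Iio 0) = 0)
    (hB : B (Set.Iio 0) = 0) : (A ∗ B) (Set.Iio 0) = 0 := by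
  rw [Measure.conv, Measure.map_apply (by fun_prop) measurableSet_Iio]
  refine measure_mono_null (t := (Set.Iio 0 ×ˢ Set.univ) ∪ (Set.univ ×ˢ Set.Iio 0)) ?_ ?_
  · rintro ⟨x, y⟩ hx
    simp at *
    by_contra! hcon
    linarith
  · apply measure_union_null <;> simp [Measure.prod_prod, hA, hB]

lemma convPow_nonneg (hF0 : F (Set.Iio 0) = 0) (k : ℕ) : convPow F k (Set.Iio 0) = 0 := by
  induction k with
  | zero => simp [convPow]
  | succ k ih => exact conv_nonneg _ _ hF0 ih

lemma conv_le (A B : Measure ℝ) [SFinite A] [SFinite B] (hA : A (Set.Iio 0) = 0)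
    (hB : B (Set.Iio 0) = 0) (t : ℝ) :
    (A ∗ B) (Set.Iic t) ≤ A (Set.Iic t) * B (Set.Iic t) := by
  rw [Measure.conv, Measure.map_apply (by fun_prop) measurableSet_Iic, ← Measure.prod_prod]
  have hn : (A.prod B) ((Set.Iio 0 ×ˢ Set.univ) ∪ (Set.univ ×ˢ Set.Iio 0)) = 0 := by
    apply measure_union_null <;> simp [Measure.prod_prod, hA, hB]
  calc _ ≤ (A.prod B) ((Set.Iic t ×ˢ Set.Iic t) ∪ ((Set.Iio 0 ×ˢ Set.univ) ∪ (Set.univ ×ˢ Set.Iio 0))) := by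
        apply measure_mono
        rintro ⟨x, y⟩ hx
        simp at *
        by_contra! hcon
        have := hcon.1 (by linarith)
        linarith
    _ ≤ _ := by
        refine (measure_union_le _ _).trans ?_
        rw [hn, add_zero]

lemma leb_conv_tendsto (h : R + leb0 ∗ F = leb0) (hF0 : F (Set.Iio 0) = 0) (t : ℝ) :
    Filter.Tendsto (fun n => (leb0 ∗ convPow F n) (Set.Iic t)) Filter.atTop (nhds 0) := by
  have h0 : leb0 (Set.Iio 0) = 0 := by
    rw [Measure.restrict_apply measurableSet_Iio, Set.Iio_inter_Ici]; simp
  have h2 := ENNReal.Tendsto.const_mul (convPow_tendsto h t) (a := ENNReal.ofReal t) (Or.inr ENNReal.ofReal_ne_top)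
  rw [mul_zero] at h2
  refine tendsto_of_tendsto_of_tendsto_of_le_of_le tendsto_const_nhds h2 (fun _ => zero_le) ?_
  intro n
  have := conv_le leb0 (convPow F n) h0 (convPow_nonneg hF0 n) t
  rwa [leb0_Iic] at this

lemma renewal_tsum (h : R + leb0 ∗ F = leb0) (hF0 : F (Set.Iio 0) = 0) (s : ℝ) (f : ℝ → ℝ≥0∞)
    (hf : ∀ x, f x ≤ (Set.Iic s).indicator 1 x) :
    ∑' k, ∫⁻ x, f x ∂(R ∗ convPow F k) = ∫⁻ x, f x ∂leb0 := by
  have h1 : Filter.Tendsto (fun n => ∫⁻ x, f x ∂(leb0 ∗ convPow F n)) Filter.atTop (nhds 0) := by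
    refine tendsto_of_tendsto_of_tendsto_of_le_of_le tendsto_const_nhds (leb_conv_tendsto h hF0 s)
      (fun _ => zero_le) ?_
    intro n
    exact (lintegral_mono hf).trans (lintegral_indicator_one_le _)
  have h2 := (ENNReal.tendsto_nat_tsum (fun k => ∫⁻ x, f x ∂(R ∗ convPow F k))).add h1
  simp_rw [leb_conv_lintegral h] at h2
  rw [add_zero] at h2
  exact tendsto_nhds_unique h2 tendsto_const_nhds

lemma conv_Iic (A B : Measure ℝ) [SFinite A] [SFinite B] (x : ℝ) :
    (A ∗ B) (Set.Iic x) = ∫⁻ u, B (Set.Iic (x - u)) ∂A := by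
  rw [Measure.conv, Measure.map_apply (by fun_prop) measurableSet_Iic,
    Measure.prod_apply (by measurability)]
  congr 1; ext u
  congr 1; ext v
  simp
  constructor <;> intro <;> linarith

/-- the integral `I_k(s,t)` -/
lemma I_eq (B : Measure ℝ) [IsProbabilityMeasure B] (s t : ℝ) (hs : 0 ≤ s) :
    (∫⁻ u, (Set.Iic s).indicator (fun u => B (Set.Iic (s + t - u))) u ∂leb0) + (leb0 ∗ B) (Set.Iic t)
      = (leb0 ∗ B) (Set.Iic (s+t)) := by
  rw [conv_Iic, conv_Iic, lintegral_indicator measurableSet_Iic, Measure.restrict_restrict measurableSet_Iic]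
  have hd : Set.Ici (0:ℝ) = (Set.Iic s ∩ Set.Ici 0) ∪ Set.Ioi s := by
    ext x; simp
    constructor
    · intro h; rcases le_or_gt x s with h1 | h1 <;> simp [*]
    · rintro (⟨_, h⟩ | h) <;> linarith
  conv_rhs => rw [leb0, hd]
  rw [lintegral_union measurableSet_Ioi (by
    rw [Set.disjoint_left]; rintro x ⟨h1, _⟩ h2; simp at *; linarith)]
  congr 1
  rw [setLIntegral_congr Ioi_ae_eq_Ici.symm, ← lintegral_indicator measurableSet_Ioi,
    ← lintegral_indicator measurableSet_Ioi]
  rw [← lintegral_add_right_eq_self (fun a => (Set.Ioi s).indicator _ a) s]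
  apply lintegral_congr
  intro u
  by_cases h : 0 < u <;> simp [Set.indicator, h]
  congr 2
  ring

lemma measurable_cdf (B : Measure ℝ) [IsProbabilityMeasure B] (c : ℝ) :
    Measurable (fun u => B (Set.Iic (c - u))) :=
  Antitone.measurable (fun a b hab => measure_mono (Set.Iic_subset_Iic.2 (by linarith)))

lemma leb_conv_ne_top (B : Measure ℝ) [IsProbabilityMeasure B] (hB : B (Set.Iio 0) = 0) (t : ℝ) :
    (leb0 ∗ B) (Set.Iic t) ≠ ⊤ := by
  have h0 : leb0 (Set.Iio 0) = 0 := by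
    rw [Measure.restrict_apply measurableSet_Iio, Set.Iio_inter_Ici]; simp
  refine ne_top_of_le_ne_top ?_ (conv_le leb0 B h0 hB t)
  rw [leb0_Iic]
  exact ENNReal.mul_ne_top ENNReal.ofReal_ne_top (measure_ne_top _ _)

/-- Key algebraic identity for stationarity. -/
lemma stationarity_algebra (h : R + leb0 ∗ F = leb0) (hF0 : F (Set.Iio 0) = 0) (s t : ℝ)
    (hs : 0 ≤ s) (k : ℕ) (c : ℝ≥0∞)
    (hc : c + ∫⁻ u, (Set.Iic s).indicator (fun u => convPow F k (Set.Iic (s + t - u))) u ∂leb0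
      = (R ∗ convPow F k) (Set.Iic (s+t))
        + ∫⁻ u, (Set.Iic s).indicator (fun u => convPow F (k+1) (Set.Iic (s + t - u))) u ∂leb0) :
    c = (R ∗ convPow F k) (Set.Iic t) := by
  have e1 := I_eq (convPow F k) s t hs
  have e2 := I_eq (convPow F (k+1)) s t hs
  have e3 : ∀ x, (R ∗ convPow F k) (Set.Iic x) + (leb0 ∗ convPow F (k+1)) (Set.Iic x)
      = (leb0 ∗ convPow F k) (Set.Iic x) := by
    intro x; rw [← leb_conv_step h k]; rfl
  have f1 := leb_conv_ne_top (convPow F k) (convPow_nonneg hF0 k) (s+t)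
  have f2 := leb_conv_ne_top (convPow F (k+1)) (convPow_nonneg hF0 (k+1)) t
  have f3 : ∫⁻ u, (Set.Iic s).indicator (fun u => convPow F k (Set.Iic (s + t - u))) u ∂leb0 ≠ ⊤ := by
    rw [← e1] at f1
    exact ne_top_of_le_ne_top f1 le_self_add
  set I0 := ∫⁻ u, (Set.Iic s).indicator (fun u => convPow F k (Set.Iic (s + t - u))) u ∂leb0
  set I1 := ∫⁻ u, (Set.Iic s).indicator (fun u => convPow F (k+1) (Set.Iic (s + t - u))) u ∂leb0
  have : c + (I0 + (leb0 ∗ convPow F (k+1)) (Set.Iic t))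
      = (R ∗ convPow F k) (Set.Iic t) + (I0 + (leb0 ∗ convPow F (k+1)) (Set.Iic t)) := by
    calc _ = (c + I0) + (leb0 ∗ convPow F (k+1)) (Set.Iic t) := by ring
      _ = (R ∗ convPow F k) (Set.Iic (s+t)) + (leb0 ∗ convPow F (k+1)) (Set.Iic (s+t)) := by
        rw [hc, ← e2]; ring
      _ = I0 + (leb0 ∗ convPow F k) (Set.Iic t) := by rw [e3, e1]
      _ = _ := by rw [← e3]; ring
  exact (ENNReal.add_left_inj (ENNReal.add_ne_top.2 ⟨f3, f2⟩)).1 this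
end

/-- a good sample path: nonnegative intervals, finitely many renewals in bounded time -/
def GoodPath (x : ℕ → ℝ) : Prop :=
  (∀ j, 0 ≤ x j) ∧ ∀ t : ℝ, BddAbove {n : ℕ | ∑ i ∈ Finset.range n, x i ≤ t}

lemma count_iff {x : ℕ → ℝ} (hx : GoodPath x) {t : ℝ} (ht : 0 ≤ t) (n : ℕ) :
    n ≤ renewalCount x t ↔ ∑ i ∈ Finset.range n, x i ≤ t := by
  constructor
  · intro h
    have hmem : renewalCount x t ∈ {n : ℕ | ∑ i ∈ Finset.range n, x i ≤ t} :=
      Nat.sSup_mem ⟨0, by simpa using ht⟩ (hx.2 t)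
    exact (Finset.sum_le_sum_of_subset_of_nonneg (Finset.range_subset_range.2 h)
      (fun i _ _ => hx.1 i)).trans hmem
  · intro h
    exact le_csSup (hx.2 t) h

lemma count_mono {x : ℕ → ℝ} (hx : GoodPath x) {s t : ℝ} (hs : 0 ≤ s) (hst : s ≤ t) :
    renewalCount x s ≤ renewalCount x t := by
  rw [count_iff hx (hs.trans hst)]
  exact ((count_iff hx hs _).1 le_rfl).trans hst

lemma measurable_count (t : ℝ) : Measurable (fun x : ℕ → ℝ => renewalCount x t) := by
  have hA : ∀ n : ℕ, MeasurableSet {x : ℕ → ℝ | ∑ i ∈ Finset.range n, x i ≤ t} := fun n =>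
    measurableSet_le (by fun_prop) measurable_const
  apply measurable_to_countable'
  intro k
  have hB : MeasurableSet {x : ℕ → ℝ | ∃ m : ℕ, ∀ n : ℕ, ∑ i ∈ Finset.range n, x i ≤ t → n ≤ m} := by
    rw [Set.ofPred_exists]
    refine MeasurableSet.iUnion fun m => ?_
    rw [Set.ofPred_forall]
    refine MeasurableSet.iInter fun n => ?_
    by_cases h : n ≤ m
    · simp [h]
    · simp only [h, imp_false]
      exact (hA n).compl
  have hC : MeasurableSet {x : ℕ → ℝ | ∀ n : ℕ, ∑ i ∈ Finset.range n, x i ≤ t → n ≤ k} := by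
    rw [Set.ofPred_forall]
    refine MeasurableSet.iInter fun n => ?_
    by_cases h : n ≤ k
    · simp [h]
    · simp only [h, imp_false]
      exact (hA n).compl
  have hD : MeasurableSet {x : ℕ → ℝ | ∀ n : ℕ, ¬ ∑ i ∈ Finset.range n, x i ≤ t} := by
    rw [Set.ofPred_forall]
    exact MeasurableSet.iInter fun n => (hA n).compl
  have e : (fun x : ℕ → ℝ => renewalCount x t) ⁻¹' {k}
      = ({x : ℕ → ℝ | ∑ i ∈ Finset.range k, x i ≤ t}
          ∩ {x : ℕ → ℝ | ∀ n : ℕ, ∑ i ∈ Finset.range n, x i ≤ t → n ≤ k})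
        ∪ (({x : ℕ → ℝ | ∃ m : ℕ, ∀ n : ℕ, ∑ i ∈ Finset.range n, x i ≤ t → n ≤ m}ᶜ
          ∪ {x : ℕ → ℝ | ∀ n : ℕ, ¬ ∑ i ∈ Finset.range n, x i ≤ t}) ∩ {_x | k = 0}) := by
    ext x
    simp only [Set.mem_preimage, Set.mem_singleton_iff, Set.mem_union, Set.mem_inter_iff,
      Set.mem_ofPred_eq, Set.mem_compl_iff]
    by_cases hb : ∃ m : ℕ, ∀ n : ℕ, ∑ i ∈ Finset.range n, x i ≤ t → n ≤ m
    · have hbd : BddAbove {n : ℕ | ∑ i ∈ Finset.range n, x i ≤ t} := by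
        obtain ⟨m, hm⟩ := hb
        exact ⟨m, fun n hn => hm n hn⟩
      by_cases hne : ∀ n : ℕ, ¬ ∑ i ∈ Finset.range n, x i ≤ t
      · have : renewalCount x t = 0 := by
          unfold renewalCount
          simp [hne]
        rw [this]
        constructor
        · intro h; right; exact ⟨Or.inr hne, h.symm⟩
        · rintro (⟨h, _⟩ | ⟨_, h⟩)
          · exact absurd h (hne k)
          · exact h.symm
      · have hmem : renewalCount x t ∈ {n : ℕ | ∑ i ∈ Finset.range n, x i ≤ t} := by
          push Not at hne
          obtain ⟨n, hn⟩ := hne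
          exact Nat.sSup_mem ⟨n, hn⟩ hbd
        constructor
        · rintro rfl
          left
          exact ⟨hmem, fun n hn => le_csSup hbd hn⟩
        · rintro (⟨h1, h2⟩ | ⟨h1 | h1, _⟩)
          · exact le_antisymm (h2 _ hmem) (le_csSup hbd h1)
          · exact absurd hb h1
          · exact absurd h1 hne
    · have : renewalCount x t = 0 := by
        unfold renewalCount
        apply Nat.sSup_of_not_bddAbove
        rintro ⟨m, hm⟩
        exact hb ⟨m, fun n hn => hm hn⟩
      rw [this]
      constructor
      · intro h; right; exact ⟨Or.inl hb, h.symm⟩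
      · rintro (⟨_, h⟩ | ⟨_, h⟩)
        · exact absurd ⟨k, h⟩ hb
        · exact h.symm
  rw [e]
  exact ((hA k).inter hC).union ((hB.compl.union hD).inter (by measurability))

section
variable {Ω : Type*} [MeasurableSpace Ω] {μ : Measure Ω} [IsProbabilityMeasure μ]
  {x : ℕ → Ω → ℝ}

lemma block_indep (hm : ∀ j, Measurable (x j)) (hind : iIndepFun x μ) (m a b : ℕ) :
    IndepFun (fun ω => ∑ i ∈ Finset.range a, x (m + i) ω)
      (fun ω => ∑ i ∈ Finset.range b, x (m + a + i) ω) μ := by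
  have hd : Disjoint (Finset.Ico m (m+a)) (Finset.Ico (m+a) (m+a+b)) :=
    Finset.Ico_disjoint_Ico_consecutive _ _ _
  have h := hind.indepFun_finset _ _ hd hm
  have h2 := h.comp (φ := fun v => ∑ i, v i) (ψ := fun v => ∑ i, v i) (by fun_prop) (by fun_prop)
  have e : ∀ p q : ℕ, ((fun v : (Finset.Ico p (p+q)) → ℝ => ∑ i, v i) ∘ fun ω (i : Finset.Ico p (p+q)) => x i ω)
      = fun ω => ∑ i ∈ Finset.range q, x (p + i) ω := by
    intro p q
    ext ω
    simp only [Function.comp]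
    rw [Finset.sum_coe_sort (Finset.Ico p (p+q)) (fun i => x i ω), Finset.sum_Ico_eq_sum_range]
    simp
  rw [e, e] at h2
  exact h2

variable {R F : Measure ℝ} [IsProbabilityMeasure R] [IsProbabilityMeasure F]

lemma block_law (hm : ∀ j, Measurable (x j)) (hind : iIndepFun x μ)
    (hF : ∀ j, μ.map (x (j+1)) = F) (k : ℕ) : ∀ m : ℕ,
    μ.map (fun ω => ∑ i ∈ Finset.range k, x (m + 1 + i) ω) = convPow F k := by
  induction k with
  | zero =>
    intro m
    simp [convPow]
  | succ k ih =>
    intro m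
    have h := block_indep hm hind (m+1) 1 k
    simp only [Finset.sum_range_one, add_zero] at h
    have := h.map_add_eq_map_conv_map (by fun_prop) (by fun_prop)
    rw [ih (m+1)] at this
    have e : (fun ω => x (m+1) ω) = x (m+1) := rfl
    rw [e, hF] at this
    rw [convPow, ← this]
    congr 1
    ext ω
    simp only [Pi.add_apply]
    rw [Finset.sum_range_succ', add_comm]
    congr 1
    apply Finset.sum_congr rfl
    intro i _
    congr 1; ring

lemma T_law (hm : ∀ j, Measurable (x j)) (hind : iIndepFun x μ) (hR : μ.map (x 0) = R)
    (hF : ∀ j, μ.map (x (j+1)) = F) (k : ℕ) :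
    μ.map (fun ω => ∑ i ∈ Finset.range (k+1), x i ω) = R ∗ convPow F k := by
  have h := block_indep hm hind 0 1 k
  simp only [Finset.sum_range_one, add_zero] at h
  have := h.map_add_eq_map_conv_map (by fun_prop) (by fun_prop)
  rw [block_law hm hind hF] at this
  have e : (fun ω => x 0 ω) = x 0 := rfl
  rw [e, hR] at this
  rw [← this]
  congr 1
  ext ω
  simp only [Pi.add_apply]
  rw [Finset.sum_range_succ', add_comm]
  congr 1
  apply Finset.sum_congr rfl
  intro i _
  congr 1; ring

lemma T_joint (hm : ∀ j, Measurable (x j)) (hind : iIndepFun x μ) (hR : μ.map (x 0) = R)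
    (hF : ∀ j, μ.map (x (j+1)) = F) (n k : ℕ) (s c : ℝ) :
    μ {ω | ∑ i ∈ Finset.range (n+1), x i ω ≤ s ∧ ∑ i ∈ Finset.range (n+1+k), x i ω ≤ c}
      = ∫⁻ u, (Set.Iic s).indicator (fun u => convPow F k (Set.Iic (c - u))) u ∂(R ∗ convPow F n) := by
  have h := block_indep hm hind 0 (n+1) k
  have h2 := h.map_prod_eq_prod_map_map (by fun_prop) (by fun_prop)
  simp only [zero_add] at h2
  rw [T_law hm hind hR hF, block_law hm hind hF] at h2
  have hS : MeasurableSet {p : ℝ × ℝ | p.1 ≤ s ∧ p.1 + p.2 ≤ c} := by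
    have h1 : MeasurableSet {p : ℝ × ℝ | p.1 ≤ s} := measurableSet_le (by fun_prop) (by fun_prop)
    have h2 : MeasurableSet {p : ℝ × ℝ | p.1 + p.2 ≤ c} :=
      measurableSet_le (by fun_prop) (by fun_prop)
    exact h1.inter h2
  have e : {ω | ∑ i ∈ Finset.range (n+1), x i ω ≤ s ∧ ∑ i ∈ Finset.range (n+1+k), x i ω ≤ c}
    = (fun ω => (∑ i ∈ Finset.range (n+1), x i ω, ∑ i ∈ Finset.range k, x (n+1+i) ω)) ⁻¹'
      {p : ℝ × ℝ | p.1 ≤ s ∧ p.1 + p.2 ≤ c} := by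
    ext ω
    simp [Finset.sum_range_add _ (n+1) k]
  rw [e, ← Measure.map_apply (by fun_prop) hS, h2, Measure.prod_apply hS]
  apply lintegral_congr
  intro u
  by_cases hu : u ≤ s
  · simp only [Set.indicator, Set.mem_Iic, hu, if_true]
    congr 1
    ext v
    simp [hu]
    constructor <;> intro <;> linarith
  · simp [Set.indicator, hu]

lemma ae_good (hm : ∀ j, Measurable (x j)) (hnn : ∀ j, ∀ᵐ ω ∂μ, 0 ≤ x j ω)
    (hind : iIndepFun x μ) (hR : μ.map (x 0) = R)
    (hF : ∀ j, μ.map (x (j+1)) = F) (h : R + leb0 ∗ F = leb0) :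
    ∀ᵐ ω ∂μ, GoodPath (fun j => x j ω) := by
  have h1 : ∀ᵐ ω ∂μ, ∀ t : ℕ, ∀ᶠ n in Filter.atTop,
      ω ∉ {ω | ∑ i ∈ Finset.range (n+1), x i ω ≤ (t:ℝ)} := by
    rw [ae_all_iff]
    intro t
    apply ae_eventually_notMem
    refine ne_top_of_le_ne_top ENNReal.ofReal_ne_top (le_trans (le_of_eq ?_) (U_sum_le h t))
    congr 1; ext n
    rw [← T_law hm hind hR hF, Measure.map_apply (by fun_prop) measurableSet_Iic]
    rfl
  filter_upwards [h1, ae_all_iff.2 hnn] with ω h1 h2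
  refine ⟨h2, fun t => ?_⟩
  obtain ⟨T, hT⟩ := exists_nat_ge t
  obtain ⟨n, hn⟩ := (h1 T).exists
  refine ⟨n, fun k hk => ?_⟩
  by_contra hlt
  apply hn
  have hk' : ∑ i ∈ Finset.range k, x i ω ≤ t := hk
  exact ((Finset.sum_le_sum_of_subset_of_nonneg (Finset.range_subset_range.2 (by omega))
      (fun i _ _ => h2 i)).trans hk').trans hT

lemma measurable_countω (hm : ∀ j, Measurable (x j)) (t : ℝ) :
    Measurable (fun ω => renewalCount (fun j => x j ω) t) :=
  (measurable_count t).comp (measurable_pi_iff.2 hm)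

lemma count_tail (hm : ∀ j, Measurable (x j)) (hnn : ∀ j, ∀ᵐ ω ∂μ, 0 ≤ x j ω)
    (hind : iIndepFun x μ) (hR : μ.map (x 0) = R)
    (hF : ∀ j, μ.map (x (j+1)) = F) (h : R + leb0 ∗ F = leb0) (hF0 : F (Set.Iio 0) = 0)
    {s t : ℝ} (hs : 0 ≤ s) (ht : 0 ≤ t) (k : ℕ) :
    μ {ω | renewalCount (fun j => x j ω) s + (k+1) ≤ renewalCount (fun j => x j ω) (s+t)}
      = μ {ω | k+1 ≤ renewalCount (fun j => x j ω) t} := by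
  have hgood := ae_good hm hnn hind hR hF h
  have hst : 0 ≤ s + t := add_nonneg hs ht
  set N : ℝ → Ω → ℕ := fun t ω => renewalCount (fun j => x j ω) t with hN
  have hNm : ∀ t, Measurable (N t) := fun t => measurable_countω hm t
  have hr : μ {ω | k+1 ≤ N t ω} = (R ∗ convPow F k) (Set.Iic t) := by
    rw [← T_law hm hind hR hF, Measure.map_apply (by fun_prop) measurableSet_Iic]
    apply measure_congr
    filter_upwards [hgood] with ω hω
    exact propext (count_iff hω ht _)
  have hAB : ∀ a b : ℕ, μ {ω | a ≤ N s ω ∧ b ≤ N (s+t) ω}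
      = μ {ω | ∑ i ∈ Finset.range a, x i ω ≤ s ∧ ∑ i ∈ Finset.range b, x i ω ≤ s + t} := by
    intro a b
    apply measure_congr
    filter_upwards [hgood] with ω hω
    exact propext (and_congr (count_iff hω hs _) (count_iff hω hst _))
  have hI : ∀ k, ∑' n, μ {ω | n+1 ≤ N s ω ∧ n+1+k ≤ N (s+t) ω}
      = ∫⁻ u, (Set.Iic s).indicator (fun u => convPow F k (Set.Iic (s + t - u))) u ∂leb0 := by
    intro k
    rw [← renewal_tsum h hF0 s]
    · congr 1; ext n
      rw [hAB, T_joint hm hind hR hF]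
    · intro u
      apply Set.indicator_le_indicator
      exact prob_le_one
  have hc : ∀ n, μ {ω | n ≤ N s ω ∧ n + (k+1) ≤ N (s+t) ω}
      = μ {ω | N s ω = n ∧ n + (k+1) ≤ N (s+t) ω} + μ {ω | n+1 ≤ N s ω ∧ n+1+k ≤ N (s+t) ω} := by
    intro n
    rw [← measure_union]
    · congr 1
      ext ω
      simp only [Set.mem_ofPred_eq, Set.mem_union]
      omega
    · rw [Set.disjoint_left]
      rintro ω ⟨h1, _⟩ ⟨h2, _⟩
      omega
    · exact (measurableSet_le measurable_const (hNm s)).inter (measurableSet_le measurable_const (hNm _))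
  have hsum : ∑' n, μ {ω | N s ω = n ∧ n + (k+1) ≤ N (s+t) ω} = μ {ω | N s ω + (k+1) ≤ N (s+t) ω} := by
    rw [← measure_iUnion]
    · congr 1; ext ω; simp
    · intro a b hab
      rw [Function.onFun, Set.disjoint_left]
      rintro ω ⟨h1, _⟩ ⟨h2, _⟩
      omega
    · intro n
      exact (measurableSet_eq_fun (hNm s) measurable_const).inter (measurableSet_le measurable_const (hNm _))
  have htot : μ {ω | N s ω + (k+1) ≤ N (s+t) ω} + ∑' n, μ {ω | n+1 ≤ N s ω ∧ n+1+k ≤ N (s+t) ω}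
      = (R ∗ convPow F k) (Set.Iic (s+t)) + ∑' n, μ {ω | n+1 ≤ N s ω ∧ n+1+(k+1) ≤ N (s+t) ω} := by
    rw [← hsum, ← ENNReal.tsum_add]
    simp_rw [← hc]
    rw [tsum_eq_zero_add' ENNReal.summable]
    congr 1
    rw [hAB, ← T_law hm hind hR hF, Measure.map_apply (by fun_prop) measurableSet_Iic]
    congr 1
    ext ω
    simp [hs]
  rw [hI, hI] at htot
  show μ {ω | N s ω + (k+1) ≤ N (s+t) ω} = μ {ω | k+1 ≤ N t ω}
  rw [hr]
  exact stationarity_algebra h hF0 s t hs k _ htot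

lemma count_stationary (hm : ∀ j, Measurable (x j)) (hnn : ∀ j, ∀ᵐ ω ∂μ, 0 ≤ x j ω)
    (hind : iIndepFun x μ) (hR : μ.map (x 0) = R)
    (hF : ∀ j, μ.map (x (j+1)) = F) (h : R + leb0 ∗ F = leb0) (hF0 : F (Set.Iio 0) = 0)
    {s t : ℝ} (hs : 0 ≤ s) (ht : 0 ≤ t) :
    μ.map (fun ω => renewalCount (fun j => x j ω) (s+t) - renewalCount (fun j => x j ω) s)
      = μ.map (fun ω => renewalCount (fun j => x j ω) t) := by
  have hNm : ∀ t, Measurable (fun ω => renewalCount (fun j => x j ω) t) := fun t => measurable_countω hm t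
  have hD : Measurable (fun ω => renewalCount (fun j => x j ω) (s+t) - renewalCount (fun j => x j ω) s) :=
    (hNm _).sub (hNm _)
  have := Measure.isProbabilityMeasure_map hD.aemeasurable (μ := μ)
  have := Measure.isProbabilityMeasure_map (hNm t).aemeasurable (μ := μ)
  apply Measure.ext_of_Ici
  intro k
  cases k with
  | zero =>
    rw [show Set.Ici 0 = (Set.univ : Set ℕ) by ext; simp]
    simp
  | succ k =>
    rw [Measure.map_apply hD measurableSet_Ici, Measure.map_apply (hNm t) measurableSet_Ici]
    have e := count_tail hm hnn hind hR hF h hF0 hs ht k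
    convert e using 2
    · ext ω
      simp only [Set.mem_preimage, Set.mem_Ici, Set.mem_ofPred_eq]
      omega
    · rfl
end

lemma seq_indep {Ω : Type*} [MeasurableSpace Ω] {μ : Measure Ω} [IsProbabilityMeasure μ]
    {ξ : ℕ → ℕ → Ω → ℝ} (hξmeas : ∀ i j, Measurable (ξ i j))
    (hindep : iIndepFun (fun p : ℕ × ℕ => ξ p.1 p.2) μ) :
    (∀ i, iIndepFun (ξ i) μ) ∧ iIndepFun (fun i ω => (fun j => ξ i j ω)) μ := by
  have h2 : ∀ i, iIndepFun (ξ i) μ := fun i =>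
    hindep.precomp (g := fun j => (i, j)) (fun a b h => by simpa using h)
  refine ⟨h2, ?_⟩
  have : ∀ i j, IsProbabilityMeasure (μ.map (ξ i j)) :=
    fun i j => Measure.isProbabilityMeasure_map (hξmeas i j).aemeasurable
  rw [iIndepFun_iff_map_fun_eq_infinitePi_map (by fun_prop)]
  have e : (fun ω i j => ξ i j ω) = (MeasurableEquiv.curry ℕ ℕ ℝ) ∘ (fun ω (p : ℕ × ℕ) => ξ p.1 p.2 ω) := by
    ext ω i j; rfl
  rw [e, ← Measure.map_map (by fun_prop) (by fun_prop),
    (iIndepFun_iff_map_fun_eq_infinitePi_map (by fun_prop)).1 hindep,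
    Measure.infinitePi_map_curry (fun i j => μ.map (ξ i j))]
  congr 1
  ext1 i
  rw [(iIndepFun_iff_map_fun_eq_infinitePi_map (by fun_prop)).1 (h2 i)]

lemma increment_lintegral {Ω : Type*} [MeasurableSpace Ω] {μ : Measure Ω} [IsProbabilityMeasure μ]
    {ξ : ℕ → ℕ → Ω → ℝ} (hξmeas : ∀ i j, Measurable (ξ i j))
    (hsi : iIndepFun (fun i ω => (fun j => ξ i j ω)) μ)
    (hgood : ∀ i, ∀ᵐ ω ∂μ, GoodPath (fun j => ξ i j ω))
    {s t : ℝ} (hs : 0 ≤ s) (ht : 0 ≤ t)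
    (hst : ∀ i, μ.map (fun ω => renewalCount (fun j => ξ i j ω) (s+t) - renewalCount (fun j => ξ i j ω) s)
      = μ.map (fun ω => renewalCount (fun j => ξ i j ω) t))
    (n : ℕ) (g : ℝ → ℝ≥0∞) :
    ∫⁻ ω, g ((∑ i ∈ Finset.range n, (renewalCount (fun j => ξ i j ω) (s+t) : ℝ))
        - ∑ i ∈ Finset.range n, (renewalCount (fun j => ξ i j ω) s : ℝ)) ∂μ
      = ∫⁻ ω, g (∑ i ∈ Finset.range n, (renewalCount (fun j => ξ i j ω) t : ℝ)) ∂μ := by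
  have hsf : iIndepFun (fun (i : Fin n) ω => (fun j => ξ i j ω)) μ :=
    hsi.precomp (g := fun i : Fin n => (i : ℕ)) Fin.val_injective
  have hNm : ∀ i t, Measurable (fun ω => renewalCount (fun j => ξ i j ω) t) :=
    fun i t => measurable_countω (hξmeas i) t
  have i1 := hsf.comp (fun _ x => renewalCount x (s+t) - renewalCount x s)
    (fun i => (measurable_count _).sub (measurable_count _))
  have i2 := hsf.comp (fun _ x => renewalCount x t) (fun i => measurable_count _)
  have hDm : ∀ i : Fin n, Measurable (fun ω => renewalCount (fun j => ξ i j ω) (s+t) - renewalCount (fun j => ξ i j ω) s) :=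
    fun i => (hNm _ _).sub (hNm _ _)
  have m1 := (iIndepFun_iff_map_fun_eq_pi_map (fun i => (hDm i).aemeasurable)).1 i1
  have m2 := (iIndepFun_iff_map_fun_eq_pi_map (fun i : Fin n => (hNm i t).aemeasurable)).1 i2
  have m3 : μ.map (fun ω (i : Fin n) => renewalCount (fun j => ξ i j ω) (s+t) - renewalCount (fun j => ξ i j ω) s)
      = μ.map (fun ω (i : Fin n) => renewalCount (fun j => ξ i j ω) t) := by
    refine m1.trans (Eq.trans ?_ m2.symm)
    congr 1
    ext1 i
    exact hst i
  have hg : Measurable (fun v : Fin n → ℕ => g (∑ i, (v i : ℝ))) := measurable_of_countable _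
  calc _ = ∫⁻ ω, (fun v : Fin n → ℕ => g (∑ i, (v i : ℝ)))
        (fun i => renewalCount (fun j => ξ i j ω) (s+t) - renewalCount (fun j => ξ i j ω) s) ∂μ := by
        apply lintegral_congr_ae
        filter_upwards [ae_all_iff.2 hgood] with ω hω
        rw [← Finset.sum_sub_distrib, Finset.sum_range]
        congr 2
        ext i
        rw [Nat.cast_sub (count_mono (hω i) hs (by linarith))]
    _ = ∫⁻ ω, (fun v : Fin n → ℕ => g (∑ i, (v i : ℝ)))
        (fun i => renewalCount (fun j => ξ i j ω) t) ∂μ := by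
        rw [← lintegral_map hg (measurable_pi_iff.2 fun i => hDm i), m3,
          lintegral_map hg (measurable_pi_iff.2 fun i => hNm i t)]
    _ = _ := by
        simp only [Finset.sum_range]

lemma chaining (X : ℝ → ℝ) (t₀ : ℝ) (d : ℕ → ℝ) (hd : ∀ j, 0 ≤ d j) (hX0 : X 0 ≤ 0) (J : ℕ)
    (hD : ∀ j ≤ J, ∀ k : ℕ, k < 2^j → X (t₀ * ((k+1 : ℕ) : ℝ) / 2^j) - X (t₀ * (k : ℝ) / 2^j) ≤ d j) :
    ∀ k : ℕ, k ≤ 2^J → X (t₀ * (k : ℝ) / 2^J) ≤ ∑ j ∈ Finset.range (J+1), d j := by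
  induction J with
  | zero =>
    intro k hk
    have h0 := hd 0
    have hk : k = 0 ∨ k = 1 := by simp at hk; omega
    rcases hk with rfl | rfl
    · simp; linarith
    · have := hD 0 le_rfl 0 (by simp)
      simp at *
      linarith
  | succ J ih =>
    intro k hk
    have ih := ih (fun j hj => hD j (by omega))
    rw [Finset.sum_range_succ]
    have h0 := hd (J+1)
    have hpow : 2^(J+1) = 2 * 2^J := by ring
    have ev : ∀ m : ℕ, t₀ * ((2 * m : ℕ) : ℝ) / 2^(J+1) = t₀ * (m : ℝ) / 2^J := by
      intro m
      push_cast
      field_simp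
      ring
    rcases Nat.even_or_odd' k with ⟨m, rfl | rfl⟩
    · rw [ev]
      have := ih m (by omega)
      linarith
    · have h1 := ih m (by omega)
      have h2 := hD (J+1) le_rfl (2*m) (by omega)
      rw [ev] at h2
      linarith

lemma const_bound (r : ℝ) (hr : 2 < r) :
    ∃ q : ℝ, 0 < q ∧ q < 1 ∧ q ^ r * q * 2 ^ (r/2) = 2 ∧
      (2:ℝ) ^ (r/2) * (2:ℝ) ^ (r/2) * (2:ℝ) ^ (r/2) / 2 / (1-q)^r / (1-q)
        ≤ (24 * (r + 1) / (r - 2)) ^ (r + 1) := by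
  have hx0 : 0 < (r-2)/(2*(r+1)) := div_pos (by linarith) (by linarith)
  have hx1 : (r-2)/(2*(r+1)) ≤ 1 := by rw [div_le_one (by linarith)]; linarith
  refine ⟨(1/2:ℝ) ^ ((r-2)/(2*(r+1))), by positivity,
    Real.rpow_lt_one (by norm_num) (by norm_num) hx0, ?_, ?_⟩
  · rw [← Real.rpow_mul (by norm_num), ← Real.rpow_add (by norm_num), one_div,
      Real.inv_rpow (by norm_num), ← Real.rpow_neg (by norm_num), ← Real.rpow_add (by norm_num)]
    conv_rhs => rw [← Real.rpow_one 2]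
    congr 1
    have : r + 1 ≠ 0 := by linarith
    field_simp
    ring
  · have hb := rpow_one_add_le_one_add_mul_self (s := -1/2) (by norm_num) hx0.le hx1
    norm_num at hb
    set q := (1/2:ℝ) ^ ((r-2)/(2*(r+1))) with hq
    have hq1 : q < 1 := Real.rpow_lt_one (by norm_num) (by norm_num) hx0
    have hK : (r-2)/(4*(r+1)) ≤ 1 - q := by
      have : (r-2)/(4*(r+1)) = (r-2)/(2*(r+1)) * (1/2) := by
        have : r + 1 ≠ 0 := by linarith
        field_simp; ring
      rw [this]
      linarith
    have hpos : 0 < (r-2)/(4*(r+1)) := div_pos (by linarith) (by linarith)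
    have h1q : 0 < 1 - q := by linarith
    have e1 : (2:ℝ) ^ (r/2) * (2:ℝ) ^ (r/2) * (2:ℝ) ^ (r/2) / 2 / (1-q)^r / (1-q)
      = (2:ℝ) ^ (r/2) * (2:ℝ) ^ (r/2) * (2:ℝ) ^ (r/2) / 2 / (1-q)^(r+1) := by
      rw [Real.rpow_add h1q, Real.rpow_one, div_div]
    have e2 : (24 * (r + 1) / (r - 2)) ^ (r + 1) = 6^(r+1) / ((r-2)/(4*(r+1)))^(r+1) := by
      rw [← Real.div_rpow (by norm_num) hpos.le]
      congr 1
      have : r + 1 ≠ 0 := by linarith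
      have : r - 2 ≠ 0 := by linarith
      field_simp
      norm_num
    rw [e1, e2]
    have e3 : (2:ℝ) ^ (r/2) * (2:ℝ) ^ (r/2) * (2:ℝ) ^ (r/2) / 2 ≤ 6^(r+1) := by
      have a1 : (2:ℝ) ^ (r/2) * (2:ℝ) ^ (r/2) * (2:ℝ) ^ (r/2) = 2^(r/2+r/2+r/2) := by
        rw [← Real.rpow_add (by norm_num), ← Real.rpow_add (by norm_num)]
      have a2 : (2:ℝ)^(r/2+r/2+r/2) ≤ 2^(2*(r+1)) :=
        Real.rpow_le_rpow_of_exponent_le (by norm_num) (by linarith)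
      have a3 : (2:ℝ)^(2*(r+1)) ≤ 6^(r+1) := by
        rw [Real.rpow_mul (by norm_num)]
        exact Real.rpow_le_rpow (by positivity) (by norm_num) (by linarith)
      have : 0 ≤ (2:ℝ)^(r/2+r/2+r/2) := by positivity
      rw [a1]
      linarith
    gcongr

lemma max_bound (x r : ℝ) (hr : 2 < r) (hx : 1/2 ≤ x) :
    max x (x ^ (r/2)) ≤ 2 ^ (r/2) / 2 * x ^ (r/2) := by
  have hx0 : 0 < x := by linarith
  have e : (2:ℝ) ^ (r/2) / 2 * x ^ (r/2) = x * (2*x)^(r/2-1) := by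
    rw [Real.rpow_sub (by positivity), Real.mul_rpow (by norm_num) hx0.le, Real.rpow_one]
    field_simp
  apply max_le
  · rw [e]
    have := Real.one_le_rpow (x := 2*x) (z := r/2-1) (by linarith) (by linarith)
    nlinarith
  · have : (2:ℝ)^(1:ℝ) ≤ 2^(r/2) := Real.rpow_le_rpow_of_exponent_le (by norm_num) (by linarith)
    rw [Real.rpow_one] at this
    have : 0 ≤ x ^ (r/2) := by positivity
    nlinarith

lemma level_term (τ lam r q C : ℝ) (hτ : 0 < τ) (hl : 0 < lam) (hq0 : 0 < q) (hq1 : q < 1)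
    (hq : q ^ r * q * 2 ^ (r/2) = 2) (j : ℕ) :
    2^j * (C * (2 ^ (r/2) / 2 * (τ / 2^j) ^ (r/2)) / ((1-q) * q^j * (lam/2)) ^ r)
      = C * τ^(r/2) * lam^(-r) * ((2:ℝ) ^ (r/2) * (2:ℝ) ^ (r/2) * (2:ℝ) ^ (r/2) / 2 / (1-q)^r) * q^j := by
  have h1q : 0 < 1 - q := by linarith
  have e2 : (2:ℝ)^r = 2^(r/2) * 2^(r/2) := by rw [← Real.rpow_add (by norm_num)]; congr 1; ring
  have e3 : ((2:ℝ)^j)^(r/2) = (2^(r/2))^j := by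
    rw [← Real.rpow_natCast_mul (by norm_num), ← Real.rpow_mul_natCast (by norm_num), mul_comm]
  have e4 : (q^j)^r = (q^r)^j := by
    rw [← Real.rpow_natCast_mul hq0.le, ← Real.rpow_mul_natCast hq0.le, mul_comm]
  rw [Real.div_rpow hτ.le (by positivity), Real.mul_rpow (by positivity) (by positivity),
    Real.mul_rpow h1q.le (by positivity), Real.div_rpow hl.le (by norm_num), e2, e3, e4,
    Real.rpow_neg hl.le]
  set a := (2:ℝ)^(r/2)
  set b := q^r
  have ha : 0 < a := by positivity
  have hb : 0 < b := by positivity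
  have e5 : (2:ℝ)^j = b^j * q^j * a^j := by rw [← mul_pow, ← mul_pow, hq]
  rw [e5]
  have : 0 < lam^r := by positivity
  have : 0 < (1-q)^r := by positivity
  field_simp

/-- Tail bound for the supremum of `n' t - ∑_{i=1}^{n'} N_i(t)` over intervals `[0, t₀]`
of length at most one, where the `N_i` are the counting processes of i.i.d. equilibrium
renewal processes with renewal distribution `S`, `E[S] = 1`.  Here `ξ i 0` is the first
(equilibrium-distributed) renewal interval of the `i`-th process and `ξ i (j+1)` its
subsequent intervals, distributed as `S`, all jointly independent. -/
theorem pooled_sup_short_intervals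
    {Ω : Type*} [MeasurableSpace Ω] (μ : Measure Ω) [IsProbabilityMeasure μ]
    (S : Ω → ℝ) (hSmeas : Measurable S) (hSnn : ∀ᵐ ω ∂μ, 0 ≤ S ω)
    (hES : ∫ ω, S ω ∂μ = 1)
    (ξ : ℕ → ℕ → Ω → ℝ)
    (hξmeas : ∀ i j, Measurable (ξ i j))
    (hξnn : ∀ i j, ∀ᵐ ω ∂μ, 0 ≤ ξ i j ω)
    (hindep : iIndepFun (fun p : ℕ × ℕ => ξ p.1 p.2) μ)
    (hlaw : ∀ i j, μ.map (ξ i (j + 1)) = μ.map S)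
    (heq : ∀ i, ∀ y : ℝ, 0 ≤ y →
      (μ {ω | y < ξ i 0 ω}).toReal = ∫ z in Set.Ioi y, (μ {ω | z < S ω}).toReal)
    (n' : ℕ) (hn' : 1 ≤ n')
    (C₂ r₂ : ℝ) (hC₂ : 0 < C₂) (hr₂ : 2 < r₂)
    (hmom : ∀ t : ℝ, 0 ≤ t → t ≤ 1 →
      ∫⁻ ω, ENNReal.ofReal
          (|(∑ i ∈ Finset.range n', (renewalCount (fun j => ξ i j ω) t : ℝ)) - (n' : ℝ) * t| ^ r₂) ∂μ
        ≤ ENNReal.ofReal (C₂ * max ((n' : ℝ) * t) (((n' : ℝ) * t) ^ (r₂ / 2)))) :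
    ∀ t₀ : ℝ, 0 ≤ t₀ → t₀ ≤ 1 → ∀ lam : ℝ, 2 ≤ lam →
      (μ {ω | (lam : EReal) ≤ ⨆ t : Set.Icc (0 : ℝ) t₀,
          (((n' : ℝ) * (t : ℝ)
            - ∑ i ∈ Finset.range n', (renewalCount (fun j => ξ i j ω) (t : ℝ) : ℝ) : ℝ) : EReal)}).toReal
        ≤ (24 * (r₂ + 1) / (r₂ - 2)) ^ (r₂ + 1) * C₂ * ((n' : ℝ) * t₀) ^ (r₂ / 2) * lam ^ (-r₂) := by
  have hSint : Integrable S μ := by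
    by_contra hcon
    rw [integral_undef hcon] at hES
    exact zero_ne_one hES
  obtain ⟨hind, hsi⟩ := seq_indep hξmeas hindep
  have hFp : IsProbabilityMeasure (μ.map S) := Measure.isProbabilityMeasure_map hSmeas.aemeasurable
  have hF0 : (μ.map S) (Set.Iio 0) = 0 := by
    rw [Measure.map_apply hSmeas measurableSet_Iio]
    refine measure_mono_null ?_ hSnn
    intro ω h
    simpa using h
  have hFI : ∀ z, (μ.map S) (Set.Ioi z) = μ {ω | z < S ω} := by
    intro z; rw [Measure.map_apply hSmeas measurableSet_Ioi]; rfl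
  have h1 : ∫⁻ z in Set.Ioi (0:ℝ), (μ.map S) (Set.Ioi z) = 1 := by
    simp_rw [hFI]
    rw [← lintegral_eq_lintegral_meas_lt μ hSnn hSmeas.aemeasurable,
      ← ofReal_integral_eq_lintegral_ofReal hSint hSnn, hES]
    simp
  have hmI : Measurable (fun z : ℝ => (μ.map S) (Set.Ioi z)) :=
    Antitone.measurable (fun a b hab => measure_mono (Set.Ioi_subset_Ioi hab))
  have hRp : ∀ i, IsProbabilityMeasure (μ.map (ξ i 0)) := fun i =>
    Measure.isProbabilityMeasure_map (hξmeas i 0).aemeasurable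
  have hren : ∀ i, μ.map (ξ i 0) + leb0 ∗ μ.map S = leb0 := by
    intro i
    apply leb_renewal _ _ hF0
    apply R_eq_density _ _ _ _ h1
    · rw [Measure.map_apply (hξmeas i 0) measurableSet_Iio]
      refine measure_mono_null ?_ (hξnn i 0)
      intro ω h
      simpa using h
    · intro y hy
      have h := heq i y hy
      have e1 : (μ.map (ξ i 0)) (Set.Ioi y) = μ {ω | y < ξ i 0 ω} := by
        rw [Measure.map_apply (hξmeas i 0) measurableSet_Ioi]; rfl
      rw [e1, ← ENNReal.ofReal_toReal (measure_ne_top μ {ω | y < ξ i 0 ω}), h]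
      simp_rw [← hFI]
      have hle : ∫⁻ z in Set.Ioi y, (μ.map S) (Set.Ioi z) ≤ 1 := by
        rw [← h1]
        exact lintegral_mono_set (Set.Ioi_subset_Ioi hy)
      rw [integral_toReal hmI.aemeasurable (Filter.Eventually.of_forall fun z => measure_lt_top _ _)]
      exact ENNReal.ofReal_toReal (ne_top_of_le_ne_top ENNReal.one_ne_top hle)
  have hgood : ∀ i, ∀ᵐ ω ∂μ, GoodPath (fun j => ξ i j ω) := fun i =>
    ae_good (hξmeas i) (hξnn i) (hind i) rfl (hlaw i) (hren i)
  intro t₀ ht0 ht1 lam hlam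
  set X : ℝ → Ω → ℝ := fun t ω =>
    (n' : ℝ) * t - ∑ i ∈ Finset.range n', (renewalCount (fun j => ξ i j ω) t : ℝ) with hX
  have hXm : ∀ t, Measurable (X t) := by
    intro t
    refine measurable_const.sub (Finset.measurable_sum _ fun i _ => ?_)
    exact (measurable_of_countable _).comp (measurable_countω (hξmeas i) t)
  have hXle : ∀ t ω, X t ω ≤ n' * t := by
    intro t ω
    have : 0 ≤ ∑ i ∈ Finset.range n', (renewalCount (fun j => ξ i j ω) t : ℝ) := by positivity
    simp only [hX]; linarith
  have hn0 : (0:ℝ) < n' := by exact_mod_cast hn'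
  have hr1 : 0 < 24 * (r₂ + 1) / (r₂ - 2) := div_pos (by linarith) (by linarith)
  have hτnn : 0 ≤ n' * t₀ := by positivity
  have hRHS : 0 ≤ (24 * (r₂ + 1) / (r₂ - 2)) ^ (r₂ + 1) * C₂ * ((n' : ℝ) * t₀) ^ (r₂ / 2) * lam ^ (-r₂) := by
    have : 0 ≤ lam := by linarith
    positivity
  refine ENNReal.toReal_le_of_le_ofReal hRHS ?_
  change μ {ω | (lam : EReal) ≤ ⨆ t : Set.Icc (0 : ℝ) t₀, ((X t ω : ℝ) : EReal)} ≤ _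
  rcases lt_or_ge ((n' : ℝ) * t₀) lam with hlt | hge
  · have : {ω | (lam : EReal) ≤ ⨆ t : Set.Icc (0 : ℝ) t₀, ((X t ω : ℝ) : EReal)} = ∅ := by
      rw [Set.eq_empty_iff_forall_notMem]
      intro ω hω
      have h2 : ⨆ t : Set.Icc (0 : ℝ) t₀, ((X t ω : ℝ) : EReal) ≤ ((n' * t₀ : ℝ) : EReal) := by
        refine iSup_le fun t => ?_
        rw [EReal.coe_le_coe_iff]
        exact (hXle t ω).trans (mul_le_mul_of_nonneg_left t.2.2 hn0.le)
      have h3 : (lam : EReal) ≤ ((n' * t₀ : ℝ) : EReal) := le_trans hω h2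
      rw [EReal.coe_le_coe_iff] at h3
      linarith
    rw [this]; simp
  -- main case
  set τ := (n' : ℝ) * t₀ with hτ
  have hτ2 : 2 ≤ τ := hlam.trans hge
  have ht0' : 0 < t₀ := by
    rcases ht0.lt_or_eq with h | h
    · exact h
    · rw [← h] at hτ; simp at hτ; linarith
  obtain ⟨J0, hJ1, hJ2⟩ := exists_nat_pow_near (x := τ) (y := 2) (by linarith) (by norm_num)
  set J := J0 + 1 with hJ
  obtain ⟨q, hq0, hq1, hq, hqc⟩ := const_bound r₂ hr₂
  have h1q : 0 < 1 - q := by linarith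
  set d : ℕ → ℝ := fun j => (1-q) * q^j * (lam/2) with hd
  have hlam0 : 0 < lam := by linarith
  have hdpos : ∀ j, 0 < d j := fun j => by simp only [hd]; positivity
  have hdsum : ∑ j ∈ Finset.range (J+1), d j < lam / 2 := by
    simp only [hd]
    rw [← Finset.sum_mul, ← Finset.mul_sum]
    have hg := mul_neg_geom_sum q (J+1)
    rw [hg]
    have : 0 < q^(J+1) := by positivity
    nlinarith
  set D : ℕ → ℕ → Ω → ℝ := fun j k ω => X (t₀ * ((k+1 : ℕ) : ℝ) / 2^j) ω - X (t₀ * (k : ℝ) / 2^j) ω with hDdef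
  -- the probability of one exceedance
  have hone : ∀ j ≤ J, ∀ k : ℕ, k < 2^j → μ {ω | d j ≤ D j k ω}
      ≤ ENNReal.ofReal (C₂ * (2 ^ (r₂/2) / 2 * (τ / 2^j) ^ (r₂/2)) / (d j) ^ r₂) := by
    intro j hj k hk
    set s := t₀ * (k : ℝ) / 2^j with hs
    set u := t₀ / 2^j with hu
    have hs0 : 0 ≤ s := by positivity
    have hu0 : 0 ≤ u := by positivity
    have hsu : t₀ * ((k+1 : ℕ) : ℝ) / 2^j = s + u := by
      rw [hs, hu]; push_cast; ring
    have hu1 : u ≤ 1 := by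
      rw [hu]
      have : (1:ℝ) ≤ 2^j := one_le_pow₀ (by norm_num)
      exact (div_le_self ht0 this).trans ht1
    have hnu : (n' : ℝ) * u = τ / 2^j := by rw [hu, hτ]; ring
    have hinc := increment_lintegral hξmeas hsi hgood hs0 hu0
      (fun i => count_stationary (hξmeas i) (hξnn i) (hind i) rfl (hlaw i) (hren i) hF0 hs0 hu0)
      n' (fun y => ENNReal.ofReal (|y - n' * u| ^ r₂))
    have hm := hmom u hu0 hu1
    rw [← hinc] at hm
    have hhalf : 1/2 ≤ τ / 2^j := by
      have h2 : (2:ℝ)^j ≤ 2^J := pow_le_pow_right₀ (by norm_num) hj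
      have h3 : (2:ℝ)^J = 2 * 2^J0 := by rw [hJ]; ring
      rw [le_div_iff₀ (by positivity)]
      linarith
    have hm2 : ∫⁻ ω, ENNReal.ofReal (|D j k ω| ^ r₂) ∂μ
        ≤ ENNReal.ofReal (C₂ * (2 ^ (r₂/2) / 2 * (τ / 2^j) ^ (r₂/2))) := by
      refine le_trans (le_of_eq ?_) (hm.trans (ENNReal.ofReal_le_ofReal ?_))
      · apply lintegral_congr
        intro ω
        simp only [hDdef, hX]
        rw [hsu, ← abs_neg]
        congr 3
        ring
      · rw [hnu]
        exact mul_le_mul_of_nonneg_left (max_bound _ _ hr₂ hhalf) hC₂.le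
    have hDm : Measurable (D j k) := (hXm _).sub (hXm _)
    have hdr : 0 < (d j) ^ r₂ := Real.rpow_pos_of_pos (hdpos j) _
    rw [ENNReal.ofReal_div_of_pos hdr]
    refine le_trans ?_ (ENNReal.div_le_div_right hm2 _)
    refine le_trans (measure_mono ?_) (meas_ge_le_lintegral_div (f := fun ω => ENNReal.ofReal (|D j k ω| ^ r₂))
      (by fun_prop) (by simpa using hdr) ENNReal.ofReal_ne_top)
    intro ω hω
    apply ENNReal.ofReal_le_ofReal
    exact Real.rpow_le_rpow (hdpos j).le (le_trans hω (le_abs_self _)) (by linarith)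
  -- inclusion of events
  have hincl : μ {ω | (lam : EReal) ≤ ⨆ t : Set.Icc (0 : ℝ) t₀, ((X t ω : ℝ) : EReal)}
      ≤ μ (⋃ j ∈ Finset.range (J+1), ⋃ k ∈ Finset.range (2^j), {ω | d j ≤ D j k ω}) := by
    apply measure_mono_ae
    filter_upwards [ae_all_iff.2 hgood] with ω hω hmem
    by_contra hcon
    have hcon' : ω ∉ ⋃ j ∈ Finset.range (J+1), ⋃ k ∈ Finset.range (2^j), {ω | d j ≤ D j k ω} := hcon
    simp only [Set.mem_iUnion, Finset.mem_range, not_exists] at hcon'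
    have hX0 : X 0 ω ≤ 0 := by simpa using hXle 0 ω
    have hch := chaining (fun t => X t ω) t₀ d (fun j => (hdpos j).le) hX0 J
      (fun j hj k hk => (not_le.1 (hcon' j (by omega) k hk)).le)
    have hsup : ⨆ t : Set.Icc (0 : ℝ) t₀, ((X t ω : ℝ) : EReal)
        ≤ ((∑ j ∈ Finset.range (J+1), d j + lam/2 : ℝ) : EReal) := by
      refine iSup_le fun t => ?_
      rw [EReal.coe_le_coe_iff]
      obtain ⟨t, htn, htt⟩ := t
      have h2J : (0:ℝ) < 2^J := by positivity
      set k := ⌊t / t₀ * 2^J⌋₊ with hk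
      have hy0 : 0 ≤ t / t₀ * 2^J := by positivity
      have hk1 : (k:ℝ) ≤ t / t₀ * 2^J := Nat.floor_le hy0
      have hk2 : t / t₀ * 2^J < k + 1 := Nat.lt_floor_add_one _
      have hkJ : k ≤ 2^J := by
        have : (k:ℝ) ≤ ((2^J : ℕ) : ℝ) := by
          push_cast
          refine hk1.trans ?_
          have : t / t₀ ≤ 1 := (div_le_one ht0').2 htt
          nlinarith
        exact_mod_cast this
      have hg := hch k hkJ
      have hle : t₀ * k / 2^J ≤ t := by
        rw [div_le_iff₀ h2J]
        calc t₀ * k ≤ t₀ * (t / t₀ * 2^J) := by gcongr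
          _ = t * 2^J := by field_simp
      have hlt : t ≤ t₀ * k / 2^J + t₀ / 2^J := by
        rw [← add_div, le_div_iff₀ h2J]
        calc t * 2^J = t₀ * (t / t₀ * 2^J) := by field_simp
          _ ≤ t₀ * (k + 1) := by gcongr
          _ = _ := by ring
      have hmonoN : ∑ i ∈ Finset.range n', (renewalCount (fun j => ξ i j ω) (t₀ * k / 2^J) : ℝ)
          ≤ ∑ i ∈ Finset.range n', (renewalCount (fun j => ξ i j ω) t : ℝ) := by
        apply Finset.sum_le_sum
        intro i _
        exact_mod_cast count_mono (hω i) (by positivity) hle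
      have hslack : n' * (t₀ / 2^J) ≤ 1 := by
        rw [← mul_div_assoc, div_le_one h2J]
        exact hJ2.le
      have : n' * t ≤ n' * (t₀ * k / 2^J) + n' * (t₀ / 2^J) := by
        rw [← mul_add]; gcongr
      simp only [hX] at hg ⊢
      linarith
    have h3 : (lam : EReal) ≤ ((∑ j ∈ Finset.range (J+1), d j + lam/2 : ℝ) : EReal) :=
      le_trans hmem hsup
    rw [EReal.coe_le_coe_iff] at h3
    linarith
  refine hincl.trans ?_
  have hτ0 : 0 < τ := by linarith
  have hterm : ∀ j, 0 ≤ C₂ * (2 ^ (r₂/2) / 2 * (τ / 2^j) ^ (r₂/2)) / (d j) ^ r₂ := by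
    intro j
    have := (hdpos j).le
    positivity
  calc μ (⋃ j ∈ Finset.range (J+1), ⋃ k ∈ Finset.range (2^j), {ω | d j ≤ D j k ω})
      ≤ ∑ j ∈ Finset.range (J+1), ∑ k ∈ Finset.range (2^j), μ {ω | d j ≤ D j k ω} := by
        refine (measure_biUnion_finset_le _ _).trans ?_
        exact Finset.sum_le_sum fun j _ => measure_biUnion_finset_le _ _
    _ ≤ ∑ j ∈ Finset.range (J+1), ∑ k ∈ Finset.range (2^j),
          ENNReal.ofReal (C₂ * (2 ^ (r₂/2) / 2 * (τ / 2^j) ^ (r₂/2)) / (d j) ^ r₂) := by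
        refine Finset.sum_le_sum fun j hj => Finset.sum_le_sum fun k hk => ?_
        exact hone j (by simp at hj; omega) k (by simpa using hk)
    _ = ENNReal.ofReal (∑ j ∈ Finset.range (J+1),
          2^j * (C₂ * (2 ^ (r₂/2) / 2 * (τ / 2^j) ^ (r₂/2)) / (d j) ^ r₂)) := by
        rw [ENNReal.ofReal_sum_of_nonneg (fun j _ => mul_nonneg (by positivity) (hterm j))]
        refine Finset.sum_congr rfl fun j _ => ?_
        rw [ENNReal.ofReal_mul (by positivity)]
        simp [ENNReal.ofReal_pow]
    _ ≤ _ := by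
        apply ENNReal.ofReal_le_ofReal
        simp only [hd]
        simp_rw [level_term τ lam r₂ q C₂ hτ0 hlam0 hq0 hq1 hq]
        rw [← Finset.mul_sum]
        have hgeo : ∑ j ∈ Finset.range (J+1), q^j ≤ 1 / (1-q) := by
          rw [le_div_iff₀ h1q, mul_comm, mul_neg_geom_sum]
          have : 0 < q^(J+1) := by positivity
          linarith
        have hA : 0 ≤ C₂ * τ^(r₂/2) * lam^(-r₂) := by positivity
        have hB : 0 ≤ (2:ℝ) ^ (r₂/2) * (2:ℝ) ^ (r₂/2) * (2:ℝ) ^ (r₂/2) / 2 / (1-q)^r₂ := by positivity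
        calc _ ≤ C₂ * τ^(r₂/2) * lam^(-r₂) *
              ((2:ℝ) ^ (r₂/2) * (2:ℝ) ^ (r₂/2) * (2:ℝ) ^ (r₂/2) / 2 / (1-q)^r₂) * (1 / (1-q)) :=
              mul_le_mul_of_nonneg_left hgeo (mul_nonneg hA hB)
          _ = C₂ * τ^(r₂/2) * lam^(-r₂) *
              ((2:ℝ) ^ (r₂/2) * (2:ℝ) ^ (r₂/2) * (2:ℝ) ^ (r₂/2) / 2 / (1-q)^r₂ / (1-q)) := by ring
          _ ≤ C₂ * τ^(r₂/2) * lam^(-r₂) * (24 * (r₂ + 1) / (r₂ - 2)) ^ (r₂ + 1) :=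
              mul_le_mul_of_nonneg_left hqc hA
          _ = _ := by ring
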